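/- Let a > 0, R > 0 with V₀ contained in B_R, let l = (l₁, l₂) ∈ ℤ² with l ≠ (0,0), and set k = k_l = (2π/a)|l|. Let u be four times continuously differentiable on an open neighborhood of the closed disk {x : |x| ≤ R}, and suppose the function S := Δ²u − k⁴u vanishes outside V₀. Then the Fourier coefficient ŝ_l := (1/a²) ∫_{V₀} S(x) \overline{φ_l(x)} dx satisfies the boundary identity ŝ_l = (1/a²) ∫_{Γ_R} ( ∂_ν Δu + i(2π/a)(l·ν) Δu ) \overline{φ_l(x)} ds(x) − (k²/a²) ∫_{Γ_R} ( ∂_ν u + i(2π/a)(l·ν) u ) \overline{φ_l(x)} ds(x), where ν = ν(x) = x/R is the outward unit normal on Γ_R. -/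

import Mathlib

open MeasureTheory Real Filter ComplexConjugate

noncomputable section

abbrev E2 := EuclideanSpace ℝ (Fin 2)

/-- The Laplacian on ℝ² as the sum of second directional derivatives. -/
def lap (f : E2 → ℂ) (x : E2) : ℂ :=
  ∑ i : Fin 2, fderiv ℝ (fun y => fderiv ℝ f y (EuclideanSpace.single i (1:ℝ))) x
    (EuclideanSpace.single i (1:ℝ))

/-- Normal derivative on the circle of radius `R`: `∂_ν f (x) = ∇f(x)·(x/R)`. -/
def dnu (R : ℝ) (f : E2 → ℂ) (x : E2) : ℂ := fderiv ℝ f x (R⁻¹ • x)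

/-- Point on the circle of radius `R` with polar angle `θ`. -/
def circPt (R θ : ℝ) : E2 := (WithLp.equiv 2 (Fin 2 → ℝ)).symm ![R * Real.cos θ, R * Real.sin θ]

/-- Arclength integral over the circle `Γ_R`. -/
def circInt (R : ℝ) (g : E2 → ℂ) : ℂ := ∫ θ in (0:ℝ)..(2*Real.pi), g (circPt R θ) * (R:ℂ)

/-- Sommerfeld radiation condition with wavenumber `k`. -/
def Sommerfeld (k : ℝ) (w : E2 → ℂ) : Prop :=
  ∀ ε > 0, ∃ r₀ : ℝ, ∀ x : E2, r₀ ≤ ‖x‖ →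
    ‖(Real.sqrt ‖x‖ : ℂ) * (fderiv ℝ w x (‖x‖⁻¹ • x) - Complex.I * (k:ℂ) * w x)‖ < ε

/-- `u` is a radiating solution of `Δ²u − k⁴u = S`. -/
def RadiatingSolution (k : ℝ) (S u : E2 → ℂ) : Prop :=
  (∀ x : E2, lap (lap u) x - (k:ℂ)^4 * u x = S x) ∧ Sommerfeld k u ∧ Sommerfeld k (lap u)

/-- `S ∈ H(B_R)`: `L²(B_R)`-limit of smooth solutions of `Δ²v = k⁴v` on `B_R`. -/
def memH (k R : ℝ) (S : E2 → ℂ) : Prop :=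
  ∃ v : ℕ → E2 → ℂ,
    (∀ j, ContDiffOn ℝ (⊤ : ℕ∞) (v j) (Metric.ball (0:E2) R)) ∧
    (∀ j, ∀ x ∈ Metric.ball (0:E2) R, lap (lap (v j)) x = (k:ℂ)^4 * v j x) ∧
    Tendsto (fun j => ∫ x in Metric.ball (0:E2) R, ‖v j x - S x‖^2) atTop (nhds 0)

/-- The open square `V₀ = (−a/2, a/2)²`. -/
def V0 (a : ℝ) : Set E2 := {x | x 0 ∈ Set.Ioo (-(a/2)) (a/2) ∧ x 1 ∈ Set.Ioo (-(a/2)) (a/2)}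

/-- Fourier basis function `φ_l(x) = exp(i (2π/a) l·x)`. -/
def phi (a : ℝ) (l : ℤ × ℤ) (x : E2) : ℂ :=
  Complex.exp (Complex.I * (2*Real.pi/a) * ((l.1 : ℂ) * ((x 0 : ℝ) : ℂ) + (l.2 : ℂ) * ((x 1 : ℝ) : ℂ)))

/-- `φ_{l₀}(x) = exp(i (2π/a) λ x₁)` for `l₀ = (λ, 0)`. -/
def phi0 (a lam : ℝ) (x : E2) : ℂ :=
  Complex.exp (Complex.I * (2*Real.pi/a) * (lam : ℂ) * ((x 0 : ℝ) : ℂ))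

/-- The first standard basis vector of the plane. -/
abbrev basis0 : E2 := EuclideanSpace.single 0 (1 : ℝ)

/-- The second standard basis vector of the plane. -/
abbrev basis1 : E2 := EuclideanSpace.single 1 (1 : ℝ)

/-- The angular unit vector at polar angle `θ`. -/
def angVec (θ : ℝ) : E2 := (-Real.sin θ) • basis0 + Real.cos θ • basis1

lemma circPt_eq (R θ : ℝ) : circPt R θ = (R * Real.cos θ) • basis0 + (R * Real.sin θ) • basis1 := by
  ext i
  fin_cases i <;> simp [circPt]

lemma circPt_eq_smul (R θ : ℝ) : circPt R θ = R • circPt 1 θ := by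
  simp [circPt_eq, smul_smul]

lemma norm_circPt (R θ : ℝ) : ‖circPt R θ‖ = |R| := by
  rw [EuclideanSpace.norm_eq, ← Real.sqrt_sq_eq_abs]
  congr 1
  simp only [circPt, Fin.sum_univ_two, Real.norm_eq_abs, sq_abs]
  simp
  linear_combination R ^ 2 * Real.sin_sq_add_cos_sq θ

lemma circPt_periodic (R : ℝ) : Function.Periodic (circPt R) (2 * π) := fun θ => by
  simp [circPt]

lemma continuous_circPt : Continuous fun p : ℝ × ℝ => circPt p.1 p.2 := by
  simp only [circPt_eq]
  fun_prop

lemma continuous_angVec : Continuous angVec := by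
  unfold angVec
  fun_prop

lemma hasDerivAt_circPt_one (θ : ℝ) : HasDerivAt (circPt 1) (angVec θ) θ := by
  have : circPt 1 = fun θ => Real.cos θ • basis0 + Real.sin θ • basis1 := by
    ext1 θ
    simp [circPt_eq]
  rw [this]
  exact ((Real.hasDerivAt_cos θ).smul_const _).add ((Real.hasDerivAt_sin θ).smul_const _)

lemma hasDerivAt_angVec (θ : ℝ) : HasDerivAt angVec (-circPt 1 θ) θ := by
  have := (((Real.hasDerivAt_sin θ).neg).smul_const basis0).add
    ((Real.hasDerivAt_cos θ).smul_const basis1)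
  refine this.congr_deriv ?_
  simp [circPt_eq]
  abel

/-- The derivative of `(r, θ) ↦ circPt r θ`. -/
def circPtDeriv (p : ℝ × ℝ) : ℝ × ℝ →L[ℝ] E2 :=
  (ContinuousLinearMap.fst ℝ ℝ ℝ).smulRight (circPt 1 p.2)
    + (ContinuousLinearMap.snd ℝ ℝ ℝ).smulRight (p.1 • angVec p.2)

lemma hasFDerivAt_circPt (p : ℝ × ℝ) :
    HasFDerivAt (fun p : ℝ × ℝ => circPt p.1 p.2) (circPtDeriv p) p := by
  have h1 : HasFDerivAt (fun p : ℝ × ℝ => p.1) (ContinuousLinearMap.fst ℝ ℝ ℝ) p := hasFDerivAt_fst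
  have h2 := (hasDerivAt_circPt_one p.2).hasFDerivAt.comp p
    (hasFDerivAt_snd (𝕜 := ℝ) (E := ℝ) (F := ℝ) (p := p))
  have h := h1.smul h2
  have heq : (fun p : ℝ × ℝ => circPt p.1 p.2) = fun p => p.1 • (circPt 1 ∘ Prod.snd) p := by
    ext1 p
    exact circPt_eq_smul _ _
  rw [heq]
  refine h.congr_fderiv ?_
  apply ContinuousLinearMap.ext
  intro v
  simp [circPtDeriv, smul_smul, mul_comm, add_comm]

lemma volume_preserving_toLp_finTwo : MeasurePreserving
    (((MeasurableEquiv.finTwoArrow (α := ℝ)).symm.trans (MeasurableEquiv.toLp 2 (Fin 2 → ℝ)))) :=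
  (volume_preserving_finTwoArrow ℝ).symm.trans (PiLp.volume_preserving_toLp (Fin 2))

/-- Polar coordinates on the closed disk. -/
lemma setIntegral_closedBall_eq_polar {E : Type*} [NormedAddCommGroup E] [NormedSpace ℝ E]
    (R : ℝ) (h : E2 → E) :
    ∫ x in Metric.closedBall (0 : E2) R, h x =
      ∫ p in Set.Icc ((0, -π) : ℝ × ℝ) (R, π), p.1 • h (circPt p.1 p.2) := by
  rw [← integral_indicator Metric.isClosed_closedBall.measurableSet,
    ← volume_preserving_toLp_finTwo.integral_comp (MeasurableEquiv.measurableEmbedding _),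
    ← integral_comp_polarCoord_symm]
  have hpt : ∀ p : ℝ × ℝ, ((MeasurableEquiv.finTwoArrow (α := ℝ)).symm.trans
      (MeasurableEquiv.toLp 2 (Fin 2 → ℝ))) (polarCoord.symm p) = circPt p.1 p.2 := by
    intro p
    ext i
    fin_cases i <;> simp [circPt, MeasurableEquiv.finTwoArrow]
  simp only [hpt]
  have hsets : polarCoord.target ∩ {p : ℝ × ℝ | p.1 ≤ R} = Set.Ioc 0 R ×ˢ Set.Ioo (-π) π := by
    ext p
    simp [polarCoord_target]
    tauto
  have hind : ∀ p ∈ polarCoord.target,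
      p.1 • (Metric.closedBall (0 : E2) R).indicator h (circPt p.1 p.2) =
        {p : ℝ × ℝ | p.1 ≤ R}.indicator (fun p => p.1 • h (circPt p.1 p.2)) p := by
    intro p hp
    have hp0 : 0 < p.1 := by simpa using hp.1
    by_cases hR : p.1 ≤ R
    · rw [Set.indicator_of_mem, Set.indicator_of_mem]
      · exact hR
      · simpa [norm_circPt, abs_of_pos hp0] using hR
    · rw [Set.indicator_of_notMem, Set.indicator_of_notMem, smul_zero]
      · exact hR
      · simpa [norm_circPt, abs_of_pos hp0] using hR
  rw [setIntegral_congr_fun polarCoord.open_target.measurableSet hind,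
    setIntegral_indicator (measurableSet_le measurable_fst measurable_const), hsets,
    Set.Icc_prod_eq]
  exact setIntegral_congr_set (Measure.set_prod_ae_eq Ioc_ae_eq_Icc Ioo_ae_eq_Icc)

/-- The divergence theorem on a disk. -/
lemma integral_closedBall_divergence {R : ℝ} (hR : 0 < R) {U : Set E2} (hU : IsOpen U)
    (hUR : Metric.closedBall (0 : E2) R ⊆ U) {A : E2 → E2 →L[ℝ] ℂ} (hA : ContDiffOn ℝ 1 A U) :
    ∫ x in Metric.closedBall (0 : E2) R,
        (fderiv ℝ A x basis0 basis0 + fderiv ℝ A x basis1 basis1) =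
      ∫ θ in (0 : ℝ)..2 * π, A (circPt R θ) (circPt R θ) := by
  set P : ℝ × ℝ → E2 := fun p => circPt p.1 p.2 with hP
  have hPU : ∀ p ∈ Set.Icc ((0, -π) : ℝ × ℝ) (R, π), P p ∈ U := by
    intro p hp
    apply hUR
    have h0 : 0 ≤ p.1 := hp.1.1
    simpa [hP, norm_circPt, abs_of_nonneg h0] using hp.2.1
  have hcA : ContinuousOn (fun p => A (P p)) (Set.Icc ((0, -π) : ℝ × ℝ) (R, π)) :=
    hA.continuousOn.comp continuous_circPt.continuousOn hPU
  have hcA' : ContinuousOn (fun p => fderiv ℝ A (P p)) (Set.Icc ((0, -π) : ℝ × ℝ) (R, π)) :=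
    (hA.continuousOn_fderiv_of_isOpen hU le_rfl).comp continuous_circPt.continuousOn hPU
  have hdA : ∀ p ∈ Set.Icc ((0, -π) : ℝ × ℝ) (R, π),
      HasFDerivAt (fun p => A (P p)) ((fderiv ℝ A (P p)).comp (circPtDeriv p)) p := by
    intro p hp
    have h := ((hA.contDiffAt (hU.mem_nhds (hPU p hp))).differentiableAt one_ne_zero).hasFDerivAt
    exact h.comp p (hasFDerivAt_circPt p)
  set f : ℝ × ℝ → ℂ := fun p => A (P p) (P p) with hf
  set g : ℝ × ℝ → ℂ := fun p => A (P p) (angVec p.2) with hg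
  set f' : ℝ × ℝ → ℝ × ℝ →L[ℝ] ℂ := fun p => (A (P p)).comp (circPtDeriv p)
    + ((fderiv ℝ A (P p)).comp (circPtDeriv p)).flip (P p) with hf'
  set g' : ℝ × ℝ → ℝ × ℝ →L[ℝ] ℂ := fun p => (A (P p)).comp
      ((ContinuousLinearMap.toSpanSingleton ℝ (-circPt 1 p.2)).comp (ContinuousLinearMap.snd ℝ ℝ ℝ))
    + ((fderiv ℝ A (P p)).comp (circPtDeriv p)).flip (angVec p.2) with hg'
  have hdiv : ∀ p, f' p (1, 0) + g' p (0, 1) =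
      p.1 • (fderiv ℝ A (P p) basis0 basis0 + fderiv ℝ A (P p) basis1 basis1) := by
    intro p
    have hsc : (Real.cos p.2 : ℂ) ^ 2 + (Real.sin p.2 : ℂ) ^ 2 = 1 := by
      norm_cast
      exact Real.cos_sq_add_sin_sq p.2
    simp only [hf', hg', hP, circPtDeriv, angVec, circPt_eq]
    simp [-Complex.ofReal_cos, -Complex.ofReal_sin]
    linear_combination (p.1 : ℂ) *
      (fderiv ℝ A ((p.1 * Real.cos p.2) • basis0 + (p.1 * Real.sin p.2) • basis1) basis0 basis0 +
       fderiv ℝ A ((p.1 * Real.cos p.2) • basis0 + (p.1 * Real.sin p.2) • basis1) basis1 basis1)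
      * hsc
  have hsub : Set.Ioo (0 : ℝ) R ×ˢ Set.Ioo (-π) π ⊆ Set.Icc ((0, -π) : ℝ × ℝ) (R, π) := by
    rw [Set.Icc_prod_eq]
    exact Set.prod_mono Set.Ioo_subset_Icc_self Set.Ioo_subset_Icc_self
  have hle : ((0, -π) : ℝ × ℝ) ≤ (R, π) := ⟨hR.le, by simpa using Real.pi_pos.le⟩
  have key := integral_divergence_prod_Icc_of_hasFDerivAt_of_le f g f' g' (0, -π) (R, π) hle
    (hcA.clm_apply continuous_circPt.continuousOn)
    (hcA.clm_apply (continuous_angVec.comp continuous_snd).continuousOn)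
    (fun p hp => (hdA p (hsub hp)).clm_apply (hasFDerivAt_circPt p))
    (fun p hp => (hdA p (hsub hp)).clm_apply
      ((hasDerivAt_angVec p.2).hasFDerivAt.comp p hasFDerivAt_snd))
    (by
      simp only [hdiv]
      refine ContinuousOn.integrableOn_compact isCompact_Icc ?_
      exact continuous_fst.continuousOn.smul
        (((hcA'.clm_apply continuousOn_const).clm_apply continuousOn_const).add
          ((hcA'.clm_apply continuousOn_const).clm_apply continuousOn_const)))
  simp only [hdiv] at key
  rw [setIntegral_closedBall_eq_polar, key]
  have hper : ∀ r, g (r, π) = g (r, -π) := by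
    intro r
    simp [hg, hP, angVec, circPt_eq]
  have hzero : ∀ θ, f (0, θ) = 0 := by
    intro θ
    simp [hf, hP, circPt_eq]
  simp only [hper, hzero, sub_self, zero_add, intervalIntegral.integral_zero, sub_zero]
  have hp : Function.Periodic (fun θ => A (circPt R θ) (circPt R θ)) (2 * π) := fun θ => by
    simp only [circPt_periodic R θ]
  have := hp.intervalIntegral_add_eq (-π) 0
  rw [zero_add, show -π + 2 * π = π by ring] at this
  exact this

lemma contDiffOn_lap {U : Set E2} (hU : IsOpen U) {n : WithTop ℕ∞} {f : E2 → ℂ}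
    (hf : ContDiffOn ℝ (n + 1 + 1) f U) : ContDiffOn ℝ n (lap f) U := by
  refine ContDiffOn.sum fun i _ => ?_
  have h1 : ContDiffOn ℝ (n + 1) (fun y => fderiv ℝ f y (EuclideanSpace.single i (1 : ℝ))) U :=
    (hf.fderiv_of_isOpen hU le_rfl).clm_apply contDiffOn_const
  exact (h1.fderiv_of_isOpen hU le_rfl).clm_apply contDiffOn_const

lemma differentiableAt_fderiv {U : Set E2} (hU : IsOpen U) {f : E2 → ℂ}
    (hf : ContDiffOn ℝ 2 f U) {x : E2} (hx : x ∈ U) : DifferentiableAt ℝ (fderiv ℝ f) x :=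
  ((hf.fderiv_of_isOpen hU (m := 1) (by norm_num)).contDiffAt
    (hU.mem_nhds hx)).differentiableAt one_ne_zero

lemma lap_eq {U : Set E2} (hU : IsOpen U) {f : E2 → ℂ} (hf : ContDiffOn ℝ 2 f U) {x : E2}
    (hx : x ∈ U) : lap f x = fderiv ℝ (fderiv ℝ f) x basis0 basis0
      + fderiv ℝ (fderiv ℝ f) x basis1 basis1 := by
  have hd := differentiableAt_fderiv hU hf hx
  simp only [lap, Fin.sum_univ_two]
  rw [fderiv_clm_apply hd (differentiableAt_const _), fderiv_clm_apply hd (differentiableAt_const _)]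
  simp

lemma lap_sub_const_mul {U : Set E2} (hU : IsOpen U) {f g : E2 → ℂ} (hf : ContDiffOn ℝ 2 f U)
    (hg : ContDiffOn ℝ 2 g U) (c : ℂ) {x : E2} (hx : x ∈ U) :
    lap (fun y => f y - c * g y) x = lap f x - c * lap g x := by
  have hd : ∀ y ∈ U, fderiv ℝ (fun y => f y - c * g y) y = fderiv ℝ f y - c • fderiv ℝ g y := by
    intro y hy
    have hfy := (hf.contDiffAt (hU.mem_nhds hy)).differentiableAt two_ne_zero
    have hgy := (hg.contDiffAt (hU.mem_nhds hy)).differentiableAt two_ne_zero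
    exact (hfy.hasFDerivAt.sub (hgy.hasFDerivAt.const_mul c)).fderiv
  have hd2 : fderiv ℝ (fderiv ℝ (fun y => f y - c * g y)) x
      = fderiv ℝ (fderiv ℝ f) x - c • fderiv ℝ (fderiv ℝ g) x := by
    rw [Filter.EventuallyEq.fderiv_eq
      (Filter.eventuallyEq_of_mem (hU.mem_nhds hx) hd)]
    exact ((differentiableAt_fderiv hU hf hx).hasFDerivAt.sub
      ((differentiableAt_fderiv hU hg hx).hasFDerivAt.const_smul c)).fderiv
  rw [lap_eq hU (hf.sub (contDiffOn_const.mul hg)) hx, lap_eq hU hf hx, lap_eq hU hg hx, hd2]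
  simp
  ring

/-- Green's identity on a disk against the exponential of a linear form. -/
lemma integral_closedBall_lap_mul_exp {R : ℝ} (hR : 0 < R) {U : Set E2} (hU : IsOpen U)
    (hUR : Metric.closedBall (0 : E2) R ⊆ U) {w : E2 → ℂ} (hw : ContDiffOn ℝ 2 w U)
    (L : E2 →L[ℝ] ℂ) :
    ∫ x in Metric.closedBall (0 : E2) R,
        (lap w x - (L basis0 ^ 2 + L basis1 ^ 2) * w x) * Complex.exp (L x) =
      circInt R fun x => (dnu R w x - L x / R * w x) * Complex.exp (L x) := by
  set A : E2 → E2 →L[ℝ] ℂ := fun x => Complex.exp (L x) • (fderiv ℝ w x - w x • L) with hA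
  have hexp : ∀ x, HasFDerivAt (fun x => Complex.exp (L x)) (Complex.exp (L x) • L) x :=
    fun x => L.hasFDerivAt.cexp
  have hA1 : ContDiffOn ℝ 1 A U := by
    refine (L.contDiff.cexp.contDiffOn).smul ?_
    exact (hw.fderiv_of_isOpen hU (by norm_num)).sub
      ((hw.of_le (by norm_num)).smul contDiffOn_const)
  have hdiv : ∀ x ∈ U, ∀ v, fderiv ℝ A x v v =
      (fderiv ℝ (fderiv ℝ w) x v v - L v ^ 2 * w x) * Complex.exp (L x) := by
    intro x hx v
    have h1 := (differentiableAt_fderiv hU hw hx).hasFDerivAt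
    have h2 := ((hw.contDiffAt (hU.mem_nhds hx)).differentiableAt two_ne_zero).hasFDerivAt
    have h3 := (hexp x).smul (h1.sub (h2.smul_const L))
    refine (congrArg (fun T : E2 →L[ℝ] E2 →L[ℝ] ℂ => T v v) h3.fderiv).trans ?_
    simp
    ring
  have key := integral_closedBall_divergence hR hU hUR hA1
  have hRc : (R : ℂ) ≠ 0 := by exact_mod_cast hR.ne'
  rw [circInt]
  refine Eq.trans ?_ (key.trans ?_)
  · refine setIntegral_congr_fun Metric.isClosed_closedBall.measurableSet fun x hx => ?_
    simp only [hdiv x (hUR hx), lap_eq hU hw (hUR hx)]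
    ring
  · refine intervalIntegral.integral_congr fun θ _ => ?_
    simp [hA, dnu]
    field_simp

/-- The linear form in the exponent of `conj (phi a l x)`. -/
def conjPhase (a : ℝ) (l : ℤ × ℤ) : E2 →L[ℝ] ℂ :=
  (-(Complex.I * (2 * π / a)) * l.1) •
      (Complex.ofRealCLM.comp (EuclideanSpace.proj 0 : E2 →L[ℝ] ℝ))
    + (-(Complex.I * (2 * π / a)) * l.2) •
      (Complex.ofRealCLM.comp (EuclideanSpace.proj 1 : E2 →L[ℝ] ℝ))

lemma conjPhase_apply (a : ℝ) (l : ℤ × ℤ) (x : E2) : conjPhase a l x =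
    -(Complex.I * (2 * π / a) * ((l.1 : ℂ) * ((x 0 : ℝ) : ℂ) + (l.2 : ℂ) * ((x 1 : ℝ) : ℂ))) := by
  simp [conjPhase]
  ring

lemma conj_phi (a : ℝ) (l : ℤ × ℤ) (x : E2) :
    conj (phi a l x) = Complex.exp (conjPhase a l x) := by
  have h2 : conj (2 : ℂ) = 2 := Complex.conj_ofNat 2
  rw [phi, ← Complex.exp_conj, conjPhase_apply]
  simp [h2]

lemma intervalIntegrable_circPt {R : ℝ} (hR : 0 < R) {g : E2 → ℂ}
    (hg : ContinuousOn g (Metric.closedBall (0 : E2) R)) (s t : ℝ) :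
    IntervalIntegrable (fun θ => g (circPt R θ) * (R : ℂ)) volume s t := by
  have hc : Continuous (circPt R) := continuous_circPt.comp (continuous_const.prodMk continuous_id)
  refine ((hg.comp_continuous hc fun θ => ?_).mul continuous_const).intervalIntegrable _ _
  simp [norm_circPt, abs_of_pos hR]

/-- Boundary integral identity for the Fourier coefficient `ŝ_l` of a source supported
in `V₀`, at the wavenumber `k = k_l = (2π/a)|l|`, `l ≠ 0`. -/
theorem fourier_coefficient_boundary_identity (a R k : ℝ) (ha : 0 < a) (hR : 0 < R)
    (hV : V0 a ⊆ Metric.ball (0:E2) R)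
    (l : ℤ × ℤ) (hl : l ≠ (0, 0))
    (hk : k = 2*Real.pi/a * Real.sqrt (((l.1 : ℝ))^2 + ((l.2 : ℝ))^2))
    (U : Set E2) (hU : IsOpen U) (hUR : Metric.closedBall (0:E2) R ⊆ U)
    (u : E2 → ℂ) (hu : ContDiffOn ℝ 4 u U)
    (hS : ∀ x ∉ V0 a, lap (lap u) x - (k:ℂ)^4 * u x = 0) :
    (1/(a:ℂ)^2) * ∫ x in V0 a, (lap (lap u) x - (k:ℂ)^4 * u x) * conj (phi a l x) =
      (1/(a:ℂ)^2) * circInt R (fun x =>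
          (dnu R (lap u) x
            + Complex.I * (2*Real.pi/a) * (((l.1:ℂ) * ((x 0 : ℝ):ℂ) + (l.2:ℂ) * ((x 1 : ℝ):ℂ)) / (R:ℂ))
              * lap u x) * conj (phi a l x))
      - ((k:ℂ)^2/(a:ℂ)^2) * circInt R (fun x =>
          (dnu R u x
            + Complex.I * (2*Real.pi/a) * (((l.1:ℂ) * ((x 0 : ℝ):ℂ) + (l.2:ℂ) * ((x 1 : ℝ):ℂ)) / (R:ℂ))
              * u x) * conj (phi a l x)) := by
  have hu2 : ContDiffOn ℝ 2 u U := hu.of_le (by norm_num)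
  have hlap : ContDiffOn ℝ 2 (lap u) U := contDiffOn_lap hU (by norm_num; exact hu)
  set L := conjPhase a l with hL
  have hk2 : L basis0 ^ 2 + L basis1 ^ 2 = -(k : ℂ) ^ 2 := by
    have hkr : k ^ 2 = (2 * π / a) ^ 2 * ((l.1 : ℝ) ^ 2 + (l.2 : ℝ) ^ 2) := by
      rw [hk, mul_pow, Real.sq_sqrt (by positivity)]
    have hkc : (k : ℂ) ^ 2 = (2 * π / a) ^ 2 * ((l.1 : ℂ) ^ 2 + (l.2 : ℂ) ^ 2) := by
      exact_mod_cast congrArg (fun t : ℝ => (t : ℂ)) hkr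
    rw [hL, conjPhase_apply, conjPhase_apply, hkc]
    simp
    linear_combination ((2 * π / a : ℂ) ^ 2 * ((l.1 : ℂ) ^ 2 + (l.2 : ℂ) ^ 2)) * Complex.I_sq
  have hw : ContDiffOn ℝ 2 (fun x => lap u x - (k : ℂ) ^ 2 * u x) U :=
    hlap.sub (contDiffOn_const.mul hu2)
  have green := integral_closedBall_lap_mul_exp hR hU hUR hw L
  have hleft : ∫ x in V0 a, (lap (lap u) x - (k : ℂ) ^ 4 * u x) * conj (phi a l x) =
      ∫ x in Metric.closedBall (0 : E2) R,
        (lap (fun x => lap u x - (k : ℂ) ^ 2 * u x) x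
          - (L basis0 ^ 2 + L basis1 ^ 2) * (lap u x - (k : ℂ) ^ 2 * u x)) * Complex.exp (L x) := by
    rw [← setIntegral_eq_of_subset_of_forall_sdiff_eq_zero
      Metric.isClosed_closedBall.measurableSet (hV.trans Metric.ball_subset_closedBall)
      (fun x hx => by rw [hS x hx.2, zero_mul])]
    refine setIntegral_congr_fun Metric.isClosed_closedBall.measurableSet fun x hx => ?_
    simp only [lap_sub_const_mul hU hlap hu2 _ (hUR hx), conj_phi, hk2]
    ring
  have hcont : ∀ f : E2 → ℂ, ContDiffOn ℝ 2 f U → ContinuousOn (fun x =>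
      (dnu R f x - L x / R * f x) * Complex.exp (L x)) (Metric.closedBall (0 : E2) R) := by
    intro f hf
    have h1 : ContinuousOn (dnu R f) U :=
      (hf.continuousOn_fderiv_of_isOpen hU (by norm_num)).clm_apply
        (continuous_const_smul R⁻¹).continuousOn
    have h2 : Continuous L := L.continuous
    exact ((h1.sub ((h2.div_const _).continuousOn.mul hf.continuousOn)).mul
      h2.cexp.continuousOn).mono hUR
  have hterm : ∀ f : E2 → ℂ, (fun x => (dnu R f x
      + Complex.I * (2*Real.pi/a) * (((l.1:ℂ) * ((x 0 : ℝ):ℂ) + (l.2:ℂ) * ((x 1 : ℝ):ℂ)) / (R:ℂ))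
        * f x) * conj (phi a l x)) =
      fun x => (dnu R f x - L x / R * f x) * Complex.exp (L x) := by
    intro f
    ext1 x
    rw [conj_phi, ← hL]
    congr 1
    rw [hL, conjPhase_apply]
    ring
  have hright : circInt R (fun x => (dnu R (fun x => lap u x - (k : ℂ) ^ 2 * u x) x
        - L x / R * (lap u x - (k : ℂ) ^ 2 * u x)) * Complex.exp (L x)) =
      circInt R (fun x => (dnu R (lap u) x - L x / R * lap u x) * Complex.exp (L x))
        - (k : ℂ) ^ 2 * circInt R (fun x => (dnu R u x - L x / R * u x) * Complex.exp (L x)) := by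
    simp only [circInt]
    rw [← intervalIntegral.integral_const_mul, ← intervalIntegral.integral_sub
      (intervalIntegrable_circPt hR (hcont _ hlap) _ _)
      ((intervalIntegrable_circPt hR (hcont _ hu2) _ _).const_mul _)]
    refine intervalIntegral.integral_congr fun θ _ => ?_
    have hx : circPt R θ ∈ U := hUR (by simp [norm_circPt, abs_of_pos hR])
    have h1 := ((hlap.contDiffAt (hU.mem_nhds hx)).differentiableAt two_ne_zero).hasFDerivAt
    have h2 := ((hu2.contDiffAt (hU.mem_nhds hx)).differentiableAt two_ne_zero).hasFDerivAt
    have h3 := (h1.sub (h2.const_mul ((k : ℂ) ^ 2))).fderiv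
    have h4 : dnu R (fun x => lap u x - (k : ℂ) ^ 2 * u x) (circPt R θ) =
        dnu R (lap u) (circPt R θ) - (k : ℂ) ^ 2 * dnu R u (circPt R θ) := by
      simp only [dnu]
      refine (congrArg (fun T : E2 →L[ℝ] ℂ => T (R⁻¹ • circPt R θ)) h3).trans ?_
      simp
      ring
    simp only [h4]
    ring
  rw [hterm, hterm, hleft, green, hright]
  ring
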